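/- For every integer q ≥ 2 and every positive integer k there exists a constant C = C(q,k) > 0 such that for all positive integers r and all real numbers j with 0 ≤ j ≤ √((k−1)·r/(q−1)), one has A_q(r, (1 − 1/q)·(r − j)) ≤ C·r^k, where A_q(r, d) for real d is the maximum size of a q-ary code of length r whose codewords have pairwise Hamming distance at least d. -/

import Mathlib

open Finset

/-- `C` is a `q`-ary code of length `m` whose codewords have pairwise Hamming
distance at least the real number `d`. -/
def IsCode (q m : ℕ) (d : ℝ) (C : Finset (Fin m → Fin q)) : Prop :=
  ∀ x ∈ C, ∀ y ∈ C, x ≠ y → d ≤ (hammingDist x y : ℝ)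

/-- `A_q(m, d)`: the maximum size of a `q`-ary code of length `m` whose codewords
have pairwise Hamming distance at least the real number `d`. -/
noncomputable def maxCodeSize (q m : ℕ) (d : ℝ) : ℕ :=
  sSup {k : ℕ | ∃ C : Finset (Fin m → Fin q), IsCode q m d C ∧ C.card = k}

/-- `χ` is an `(r, s)`-coloring of the complete graph on `Fin N`: each edge receives
an `s`-element subset of a palette of `r` colors. -/
def IsSetColoring (N r s : ℕ) (χ : Fin N → Fin N → Finset (Fin r)) : Prop :=
  (∀ i j, χ i j = χ j i) ∧ ∀ i j : Fin N, i ≠ j → (χ i j).card = s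

/-- The set-coloring `χ` contains a monochromatic clique on `n` vertices: a set of `n`
vertices and a color contained in the color set of every edge between them. -/
def HasMonoClique {N r : ℕ} (χ : Fin N → Fin N → Finset (Fin r)) (n : ℕ) : Prop :=
  ∃ (S : Finset (Fin N)) (c : Fin r), S.card = n ∧
    ∀ i ∈ S, ∀ j ∈ S, i ≠ j → c ∈ χ i j

/-- The set-coloring Ramsey number `R(n; r, s)`: the minimum `N` such that every
`(r, s)`-coloring of the complete graph on `N` vertices contains a monochromatic
clique on `n` vertices. -/
noncomputable def setRamsey (n r s : ℕ) : ℕ :=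
  sInf {N : ℕ | ∀ χ : Fin N → Fin N → Finset (Fin r),
    IsSetColoring N r s χ → HasMonoClique χ n}

/-- `elemSym c i` is the `i`-th elementary symmetric polynomial evaluated at the family `c`. -/
def elemSym {ι : Type*} [Fintype ι] (c : ι → ℝ) (i : ℕ) : ℝ :=
  ∑ S ∈ powersetCard i univ, ∏ l ∈ S, c l

/-- The sum of `∏ l ∈ S \ {m}, c l` over all `i`-element sets `S` and all `m ∈ S`. -/
def elemSymErase {ι : Type*} [Fintype ι] [DecidableEq ι] (c : ι → ℝ) (i : ℕ) : ℝ :=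
  ∑ S ∈ powersetCard i univ, ∑ m ∈ S, ∏ l ∈ S.erase m, c l

section ElemSym

variable {ι : Type*} [Fintype ι]

@[simp]
theorem elemSym_zero (c : ι → ℝ) : elemSym c 0 = 1 := by
  simp [elemSym]

theorem elemSym_one (c : ι → ℝ) : elemSym c 1 = ∑ l, c l := by
  simp [elemSym, powersetCard_one]

theorem elemSym_const (b : ℝ) (i : ℕ) :
    elemSym (fun _ : ι => b) i = (Fintype.card ι).choose i * b ^ i := by
  unfold elemSym
  rw [Finset.sum_congr rfl (g := fun _ => b ^ i)]
  · simp [card_powersetCard]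
  · intro S hS
    simp [(mem_powersetCard.1 hS).2]

variable [DecidableEq ι]

theorem sum_powersetCard_succ_sum_mem (f : Finset ι → ι → ℝ) (i : ℕ) :
    ∑ S ∈ powersetCard (i + 1) univ, ∑ l ∈ S, f (S.erase l) l =
      ∑ S ∈ powersetCard i univ, ∑ l ∈ Sᶜ, f S l := by
  rw [Finset.sum_sigma', Finset.sum_sigma']
  refine Finset.sum_bij' (fun p _ => ⟨p.1.erase p.2, p.2⟩) (fun p _ => ⟨insert p.2 p.1, p.2⟩)
    ?_ ?_ ?_ ?_ ?_
  · rintro ⟨S, l⟩ h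
    simp only [mem_sigma, mem_powersetCard] at h
    simp [mem_powersetCard, card_erase_of_mem h.2, h.1.2]
  · rintro ⟨S, l⟩ h
    simp only [mem_sigma, mem_powersetCard, mem_compl] at h
    simp [mem_powersetCard, card_insert_of_notMem h.2, h.1.2]
  · rintro ⟨S, l⟩ h
    simp only [mem_sigma] at h
    simp [insert_erase h.2]
  · rintro ⟨S, l⟩ h
    simp only [mem_sigma, mem_compl] at h
    simp [erase_insert h.2]
  · rintro ⟨S, l⟩ h
    rfl

@[simp]
theorem elemSymErase_zero (c : ι → ℝ) : elemSymErase c 0 = 0 := by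
  simp [elemSymErase]

theorem elemSymErase_succ (c : ι → ℝ) (i : ℕ) :
    elemSymErase c (i + 1) = ((Fintype.card ι : ℝ) - i) * elemSym c i := by
  unfold elemSymErase elemSym
  rw [sum_powersetCard_succ_sum_mem (fun S _ => ∏ l ∈ S, c l), mul_sum]
  refine Finset.sum_congr rfl fun S hS => ?_
  have hS' := (mem_powersetCard.1 hS).2
  rw [sum_const, card_compl, nsmul_eq_mul, Nat.cast_sub (card_le_univ S), hS']

theorem succ_mul_elemSym_succ (c : ι → ℝ) (i : ℕ) :
    ((i : ℝ) + 1) * elemSym c (i + 1) =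
      ∑ S ∈ powersetCard i univ, ∑ l ∈ Sᶜ, c l * ∏ m ∈ S, c m := by
  rw [← sum_powersetCard_succ_sum_mem (fun S l => c l * ∏ m ∈ S, c m), elemSym, mul_sum]
  refine Finset.sum_congr rfl fun S hS => ?_
  rw [Finset.sum_congr rfl fun l hl => mul_prod_erase S c hl]
  simp [(mem_powersetCard.1 hS).2]

/-- The three-term recurrence for the elementary symmetric polynomials of numbers which all
satisfy the same quadratic equation. -/
theorem sum_mul_elemSym (c : ι → ℝ) (A B : ℝ) (hc : ∀ l, c l ^ 2 = A * c l + B) (i : ℕ) :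
    (∑ l, c l) * elemSym c i =
      (i + 1) * elemSym c (i + 1) + i * A * elemSym c i + B * elemSymErase c i := by
  rw [succ_mul_elemSym_succ]
  unfold elemSym elemSymErase
  rw [mul_sum, mul_sum, mul_sum, ← sum_add_distrib, ← sum_add_distrib]
  refine Finset.sum_congr rfl fun S hS => ?_
  rw [← sum_compl_add_sum S, add_mul, sum_mul, sum_mul, add_assoc]
  congr 1
  have h : ∀ l ∈ S, c l * ∏ m ∈ S, c m = A * ∏ m ∈ S, c m + B * ∏ m ∈ S.erase l, c m := by
    intro l hl
    rw [← mul_prod_erase S c hl]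
    linear_combination (∏ m ∈ S.erase l, c m) * hc l
  rw [Finset.sum_congr rfl h, sum_add_distrib, ← mul_sum]
  simp only [sum_const, (mem_powersetCard.1 hS).2, nsmul_eq_mul, mul_sum]
  ring

end ElemSym

/-- A real kernel which is the Gram kernel of a finite-dimensional family of vectors. -/
def IsGram {V : Type} (K : V → V → ℝ) : Prop :=
  ∃ (ι : Type) (_ : Fintype ι) (f : ι → V → ℝ), ∀ x y, K x y = ∑ i, f i x * f i y

namespace IsGram

variable {V : Type} {K L : V → V → ℝ}

theorem const {a : ℝ} (ha : 0 ≤ a) : IsGram (fun _ _ : V => a) :=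
  ⟨Unit, inferInstance, fun _ _ => Real.sqrt a, fun _ _ => by simp [Real.mul_self_sqrt ha]⟩

theorem add (hK : IsGram K) (hL : IsGram L) : IsGram (fun x y => K x y + L x y) := by
  obtain ⟨ι, _, f, hf⟩ := hK
  obtain ⟨κ, _, g, hg⟩ := hL
  exact ⟨ι ⊕ κ, inferInstance, Sum.elim f g, fun x y => by simp [hf, hg]⟩

theorem mul (hK : IsGram K) (hL : IsGram L) : IsGram (fun x y => K x y * L x y) := by
  obtain ⟨ι, _, f, hf⟩ := hK
  obtain ⟨κ, _, g, hg⟩ := hL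
  refine ⟨ι × κ, inferInstance, fun p x => f p.1 x * g p.2 x, fun x y => ?_⟩
  simp only [hf, hg, sum_mul_sum, Fintype.sum_prod_type]
  exact Finset.sum_congr rfl fun i _ => Finset.sum_congr rfl fun j _ => by ring

theorem const_mul {a : ℝ} (ha : 0 ≤ a) (hK : IsGram K) : IsGram (fun x y => a * K x y) :=
  (const ha).mul hK

theorem sum {ι : Type*} (s : Finset ι) {K : ι → V → V → ℝ} (h : ∀ i ∈ s, IsGram (K i)) :
    IsGram (fun x y => ∑ i ∈ s, K i x y) := by
  classical
  induction s using Finset.induction_on with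
  | empty => simpa using const (V := V) le_rfl
  | insert a s ha ih =>
    simp only [sum_insert ha]
    exact (h a (mem_insert_self a s)).add (ih fun i hi => h i (mem_insert_of_mem hi))

theorem prod {ι : Type*} (s : Finset ι) {K : ι → V → V → ℝ} (h : ∀ i ∈ s, IsGram (K i)) :
    IsGram (fun x y => ∏ i ∈ s, K i x y) := by
  classical
  induction s using Finset.induction_on with
  | empty => simpa using const (V := V) zero_le_one
  | insert a s ha ih =>
    simp only [prod_insert ha]
    exact (h a (mem_insert_self a s)).mul (ih fun i hi => h i (mem_insert_of_mem hi))

theorem sum_sum_nonneg (hK : IsGram K) (C : Finset V) : 0 ≤ ∑ x ∈ C, ∑ y ∈ C, K x y := by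
  obtain ⟨ι, _, f, hf⟩ := hK
  have h : ∑ x ∈ C, ∑ y ∈ C, K x y = ∑ i, (∑ x ∈ C, f i x) ^ 2 := by
    simp only [hf, sq, sum_mul_sum]
    rw [sum_comm (s := univ)]
    exact Finset.sum_congr rfl fun x _ => sum_comm
  rw [h]
  positivity

/-- The linear programming bound for a kernel with a positive constant component. -/
theorem card_mul_le {F : V → V → ℝ} {w D : ℝ} (hF : IsGram (fun x y => F x y - w))
    (C : Finset V) (hoff : ∀ x ∈ C, ∀ y ∈ C, x ≠ y → F x y ≤ 0)
    (hdiag : ∀ x ∈ C, F x x ≤ D) (hD : 0 ≤ D) : C.card * w ≤ D := by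
  classical
  have h₁ := hF.sum_sum_nonneg C
  have h₂ : ∑ x ∈ C, ∑ y ∈ C, F x y ≤ ∑ x ∈ C, D := by
    refine Finset.sum_le_sum fun x hx => ?_
    rw [← add_sum_erase C _ hx]
    have : ∑ y ∈ C.erase x, F x y ≤ 0 := Finset.sum_nonpos fun y hy =>
      hoff x hx y (mem_of_mem_erase hy) (ne_of_mem_erase hy).symm
    linarith [hdiag x hx]
  simp only [sum_sub_distrib, sum_const, nsmul_eq_mul] at h₁ h₂
  rcases C.eq_empty_or_nonempty with rfl | hC
  · simpa using hD
  · have hpos : (0 : ℝ) < C.card := by exact_mod_cast hC.card_pos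
    refine le_of_mul_le_mul_left ?_ hpos
    linarith

end IsGram

/-- The kernel on words of length `m` that compares the letters in position `l`: it is `q - 1` if
they agree and `-1` otherwise. -/
def letterKernel {q m : ℕ} (x y : Fin m → Fin q) (l : Fin m) : ℝ :=
  q * (if x l = y l then 1 else 0) - 1

section Kernel

variable {q m : ℕ}

theorem letterKernel_sq (x y : Fin m → Fin q) (l : Fin m) :
    letterKernel x y l ^ 2 = ((q : ℝ) - 2) * letterKernel x y l + (q - 1) := by
  unfold letterKernel
  split_ifs <;> ring

theorem letterKernel_self (x : Fin m → Fin q) : letterKernel x x = fun _ => (q : ℝ) - 1 := by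
  funext l
  simp [letterKernel]

theorem sum_letterKernel (x y : Fin m → Fin q) :
    ∑ l, letterKernel x y l = q * ((m : ℝ) - hammingDist x y) - m := by
  have h : ∀ l, letterKernel x y l = q - 1 - q * (if x l ≠ y l then 1 else 0) := by
    intro l
    unfold letterKernel
    by_cases h : x l = y l <;> simp [h]
  simp only [h, sum_sub_distrib, ← mul_sum, sum_boole, hammingDist]
  simp
  ring

theorem isGram_letterKernel (hq : 0 < q) (l : Fin m) :
    IsGram (fun x y : Fin m → Fin q => letterKernel x y l) := by
  have hq' : (0 : ℝ) < q := by exact_mod_cast hq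
  refine ⟨Fin q, inferInstance,
    fun e x => (q * (if x l = e then 1 else 0) - 1) / Real.sqrt q, fun x y => ?_⟩
  have h : ∀ e : Fin q, ((q : ℝ) * (if x l = e then 1 else 0) - 1) / Real.sqrt q *
      ((q * (if y l = e then 1 else 0) - 1) / Real.sqrt q) =
      q * (if y l = e then (if x l = e then 1 else 0) else 0) - (if x l = e then 1 else 0) -
        (if y l = e then 1 else 0) + 1 / q := by
    intro e
    rw [div_mul_div_comm, Real.mul_self_sqrt hq'.le]
    split_ifs <;> field_simp <;> ring
  simp only [h, sum_add_distrib, sum_sub_distrib, ← mul_sum]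
  simp [letterKernel, hq'.ne']

theorem isGram_elemSym (hq : 0 < q) (i : ℕ) :
    IsGram (fun x y : Fin m → Fin q => elemSym (letterKernel x y) i) :=
  IsGram.sum _ fun _ _ => IsGram.prod _ fun l _ => isGram_letterKernel hq l

theorem isGram_elemSymErase (hq : 0 < q) (i : ℕ) :
    IsGram (fun x y : Fin m → Fin q => elemSymErase (letterKernel x y) i) :=
  IsGram.sum _ fun _ _ => IsGram.sum _ fun _ _ => IsGram.prod _ fun l _ =>
    isGram_letterKernel hq l

theorem isGram_prod_sq_sub (hq : 2 ≤ q) (S : Finset (Fin m)) :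
    IsGram (fun x y : Fin m → Fin q =>
      (∏ l ∈ S, letterKernel x y l) * (∏ l ∈ S, letterKernel x y l) - ((q : ℝ) - 1) ^ S.card) := by
  have hq' : (2 : ℝ) ≤ q := by exact_mod_cast hq
  have hq₀ : 0 < q := by omega
  induction S using Finset.induction_on with
  | empty => simpa using IsGram.const (V := Fin m → Fin q) le_rfl
  | insert a S ha ih =>
    have hP := IsGram.prod S fun l _ => isGram_letterKernel (m := m) hq₀ l
    convert ((IsGram.const_mul (sub_nonneg.2 hq') (isGram_letterKernel hq₀ a)).mul
      (hP.mul hP)).add (IsGram.const_mul (by linarith : (0 : ℝ) ≤ (q : ℝ) - 1) ih) using 3 with x y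
    rw [prod_insert ha, card_insert_of_notMem ha]
    linear_combination (∏ l ∈ S, letterKernel x y l) ^ 2 * letterKernel_sq x y a

theorem isGram_elemSym_sq_sub (hq : 2 ≤ q) (i : ℕ) :
    IsGram (fun x y : Fin m → Fin q => elemSym (letterKernel x y) i * elemSym (letterKernel x y) i -
      (m.choose i : ℝ) * ((q : ℝ) - 1) ^ i) := by
  have hq₀ : 0 < q := by omega
  have hsum : IsGram (fun x y : Fin m → Fin q => ∑ S ∈ powersetCard i univ,
      ∑ T ∈ powersetCard i univ, ((∏ l ∈ S, letterKernel x y l) * (∏ l ∈ T, letterKernel x y l) -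
        if S = T then ((q : ℝ) - 1) ^ i else 0)) := by
    refine IsGram.sum _ fun S hS => IsGram.sum _ fun T _ => ?_
    by_cases hST : S = T
    · subst hST
      have := isGram_prod_sq_sub hq S
      rw [(mem_powersetCard.1 hS).2] at this
      simpa using this
    · simpa [hST] using (IsGram.prod S fun l _ => isGram_letterKernel hq₀ l).mul
        (IsGram.prod T fun l _ => isGram_letterKernel hq₀ l)
  convert hsum using 3 with x y
  simp only [sum_sub_distrib, elemSym, sum_mul_sum]
  congr 1
  rw [Finset.sum_congr rfl (g := fun _ => ((q : ℝ) - 1) ^ i)]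
  · simp [card_powersetCard]
  · intro S hS
    rw [Finset.sum_ite_eq, if_pos hS]

end Kernel

theorem maxCodeSize_le {q m : ℕ} {d b : ℝ}
    (h : ∀ C : Finset (Fin m → Fin q), IsCode q m d C → (C.card : ℝ) ≤ b) :
    (maxCodeSize q m d : ℝ) ≤ b := by
  have hb : 0 ≤ b := by simpa using h ∅ (by simp [IsCode])
  refine (Nat.le_floor_iff hb).1 (csSup_le ⟨0, ∅, by simp [IsCode]⟩ ?_)
  rintro _ ⟨C, hC, rfl⟩
  exact Nat.le_floor (h C hC)

/-- Distinct codewords of a code of distance `(1 - 1/q) (m - j)` are almost orthogonal. -/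
theorem IsCode.sum_letterKernel_le {q m : ℕ} (hq : 0 < q) {j : ℝ} {C : Finset (Fin m → Fin q)}
    (hC : IsCode q m ((1 - 1 / (q : ℝ)) * ((m : ℝ) - j)) C) {x y : Fin m → Fin q}
    (hx : x ∈ C) (hy : y ∈ C) (hxy : x ≠ y) :
    ∑ l, letterKernel x y l ≤ ((q : ℝ) - 1) * j := by
  have hq' : (0 : ℝ) < q := by exact_mod_cast hq
  have h := mul_le_mul_of_nonneg_left (hC x hx y hy hxy) hq'.le
  have h' : (q : ℝ) * ((1 - 1 / (q : ℝ)) * ((m : ℝ) - j)) = (q - 1) * (m - j) := by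
    field_simp
  rw [h'] at h
  rw [sum_letterKernel]
  linarith

theorem sum_letterKernel_add_nonneg {q m : ℕ} (x y : Fin m → Fin q) :
    0 ≤ ∑ l, letterKernel x y l + m := by
  have h : (hammingDist x y : ℝ) ≤ m := by
    exact_mod_cast (hammingDist_le_card_fintype (x := x) (y := y)).trans_eq (Fintype.card_fin m)
  rw [sum_letterKernel]
  have : (0 : ℝ) ≤ q * (m - hammingDist x y) := mul_nonneg (by positivity) (by linarith)
  linarith

theorem IsCode.card_le_mul {q r : ℕ} (hq : 2 ≤ q) (hr : 0 < r)
    {C : Finset (Fin r → Fin q)} (h : ∀ x ∈ C, ∀ y ∈ C, x ≠ y → ∑ l, letterKernel x y l ≤ 0) :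
    (C.card : ℝ) ≤ q * r := by
  have hq₀ : 0 < q := by omega
  have hq' : (2 : ℝ) ≤ q := by exact_mod_cast hq
  have hr' : (0 : ℝ) < r := by exact_mod_cast hr
  have hn : (0 : ℝ) < (q - 1) * r := mul_pos (by linarith) hr'
  have hF : IsGram (fun x y : Fin r → Fin q =>
      (∑ l, letterKernel x y l) * (∑ l, letterKernel x y l + r) - (q - 1) * r) := by
    convert (IsGram.const_mul (zero_le_two (α := ℝ)) (isGram_elemSym (m := r) hq₀ 2)).add
      (IsGram.const_mul (by linarith : (0 : ℝ) ≤ q - 2 + r) (isGram_elemSym (m := r) hq₀ 1))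
      using 3 with x y
    have h₁ := sum_mul_elemSym (letterKernel x y) _ _ (letterKernel_sq x y) 1
    rw [elemSymErase_succ, elemSym_zero, Fintype.card_fin] at h₁
    have h₂ := elemSym_one (letterKernel x y)
    push_cast at h₁
    linear_combination h₁ - (∑ l, letterKernel x y l + r) * h₂
  have hle := hF.card_mul_le C (D := (q - 1) * r * (q * r)) (fun x hx y hy hxy =>
    mul_nonpos_of_nonpos_of_nonneg (h x hx y hy hxy) (sum_letterKernel_add_nonneg x y))
    (fun x _ => by simp [letterKernel_self]; apply le_of_eq; ring) (by positivity)
  refine le_of_mul_le_mul_right ?_ hn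
  linarith

theorem lp_coeff_bounds {S Q R : ℝ} (hS : 0 ≤ S) (hQ : 2 ≤ Q) (hR : 16 * (S + 1) * Q ≤ R) :
    √(S + 1) * (Q - 1) * S ≤ R * √((Q - 1) * R) ∧
    √(S + 1) * (Q - 1) * S * (S * (Q - 2) + R) ≤ √((Q - 1) * R) * S * ((Q - 1) * (R - S + 1)) ∧
    √(S + 1) * (Q - 1) * S * (S + 1) + √(S + 1) * (Q - 1) * R ≤
      √(S + 1) * (S + 2) * ((Q - 1) * (R - S - 1)) := by
  have hSQ : 0 ≤ S * (Q - 2) := mul_nonneg hS (by linarith)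
  have hR₀ : 0 ≤ R := le_trans (by positivity) hR
  have hβ := Real.sqrt_nonneg (S + 1)
  have hα : 4 * √(S + 1) ≤ √((Q - 1) * R) := by
    apply Real.le_sqrt_of_sq_le
    rw [mul_pow, Real.sq_sqrt (by linarith)]
    nlinarith
  refine ⟨?_, ?_, ?_⟩
  · have h : (Q - 1) * S ≤ R := by nlinarith
    nlinarith [mul_le_mul_of_nonneg_left h hβ]
  · have h₁ : √(S + 1) * (S * (Q - 2) + R) ≤ √((Q - 1) * R) * (R - S + 1) :=
      calc √(S + 1) * (S * (Q - 2) + R) ≤ √(S + 1) * (4 * (R - S + 1)) :=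
            mul_le_mul_of_nonneg_left (by nlinarith) hβ
        _ = 4 * √(S + 1) * (R - S + 1) := by ring
        _ ≤ _ := mul_le_mul_of_nonneg_right hα (by nlinarith)
    have h₂ := mul_le_mul_of_nonneg_left h₁ (mul_nonneg (by linarith : 0 ≤ Q - 1) hS)
    linarith
  · have h : S * (S + 1) + R ≤ (S + 2) * (R - S - 1) := by nlinarith
    have h₂ := mul_le_mul_of_nonneg_left h (mul_nonneg hβ (by linarith : 0 ≤ Q - 1))
    linarith

/-- The kernel certifying the linear programming bound: `(X - αβ) (X + m) (α L_s + β L_{s+1})²`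
with `X = ∑ l, letterKernel x y l`, `L_i` its elementary symmetric kernels, `α = √((q-1) m)` and
`β = √(s+1)`. -/
noncomputable def lpKernel {q m : ℕ} (s : ℕ) (x y : Fin m → Fin q) : ℝ :=
  (∑ l, letterKernel x y l - √(((q : ℝ) - 1) * m) * √((s : ℝ) + 1)) *
    (∑ l, letterKernel x y l + m) *
    (√(((q : ℝ) - 1) * m) * elemSym (letterKernel x y) s +
      √((s : ℝ) + 1) * elemSym (letterKernel x y) (s + 1)) ^ 2

section LinearProgramming

variable {q m : ℕ}

theorem isGram_sum_mul_elemSymErase_sub (hq : 2 ≤ q) {s : ℕ} (hs : s ≤ m) :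
    IsGram (fun x y : Fin m → Fin q =>
      (∑ l, letterKernel x y l) * elemSymErase (letterKernel x y) s -
        s * ((m : ℝ) - s + 1) * elemSym (letterKernel x y) s) := by
  have hq' : (2 : ℝ) ≤ q := by exact_mod_cast hq
  have hq₀ : 0 < q := by omega
  cases s with
  | zero => simpa using IsGram.const (V := Fin m → Fin q) le_rfl
  | succ t =>
    have ht : (0 : ℝ) ≤ m - t := by
      have : ((t + 1 : ℕ) : ℝ) ≤ m := by exact_mod_cast hs
      push_cast at this
      linarith
    convert IsGram.const_mul ht ((IsGram.const_mul
      (mul_nonneg t.cast_nonneg (sub_nonneg.2 hq')) (isGram_elemSym (m := m) hq₀ t)).add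
      (IsGram.const_mul (by linarith : (0 : ℝ) ≤ (q : ℝ) - 1) (isGram_elemSymErase hq₀ t)))
      using 3 with x y
    rw [elemSymErase_succ, Fintype.card_fin]
    push_cast
    linear_combination ((m : ℝ) - t) *
      sum_mul_elemSym (letterKernel x y) _ _ (letterKernel_sq x y) t

theorem isGram_lpKernel_sub (hq : 2 ≤ q) {s : ℕ} (hm : 16 * (s + 1) * q ≤ m) :
    IsGram (fun x y : Fin m → Fin q => lpKernel s x y -
      ((s : ℝ) + 1) * (((q : ℝ) - 1) * m) * (m.choose (s + 1) * ((q : ℝ) - 1) ^ (s + 1))) := by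
  have hq' : (2 : ℝ) ≤ q := by exact_mod_cast hq
  have hq₀ : 0 < q := by omega
  have hq₁ : (0 : ℝ) ≤ (q : ℝ) - 1 := by linarith
  have hq₂ : (0 : ℝ) ≤ (q : ℝ) - 2 := by linarith
  have hs : s ≤ m := by nlinarith
  have hs₀ : (0 : ℝ) ≤ s := s.cast_nonneg
  have hm₀ : (0 : ℝ) ≤ m := m.cast_nonneg
  have hmR : 16 * ((s : ℝ) + 1) * q ≤ m := by exact_mod_cast hm
  obtain ⟨b₁, b₂, b₃⟩ := lp_coeff_bounds hs₀ hq' hmR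
  have hα₂ : √(((q : ℝ) - 1) * m) ^ 2 = ((q : ℝ) - 1) * m := Real.sq_sqrt (by positivity)
  have hβ₂ : √((s : ℝ) + 1) ^ 2 = s + 1 := Real.sq_sqrt (by positivity)
  unfold lpKernel
  set α := √(((q : ℝ) - 1) * m)
  set β := √((s : ℝ) + 1)
  have hα : 0 ≤ α := Real.sqrt_nonneg _
  have hβ : 0 ≤ β := Real.sqrt_nonneg _
  have L := isGram_elemSym (m := m) hq₀
  have hG := (IsGram.const_mul hα (L s)).add (IsGram.const_mul hβ (L (s + 1)))
  have hU := IsGram.const_mul (mul_nonneg hα hq₁) (isGram_sum_mul_elemSymErase_sub hq hs)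
  have hT := IsGram.const_mul (mul_nonneg (sub_nonneg.2 b₁) hq₁)
    (isGram_elemSymErase (m := m) hq₀ s)
  have h₀ := IsGram.const_mul (sub_nonneg.2 b₂) (L s)
  have h₁ := IsGram.const_mul (sub_nonneg.2 b₃) (L (s + 1))
  have h₂ := IsGram.const_mul (by positivity :
    0 ≤ β * ((s : ℝ) + 2) * ((s + 2) * ((q : ℝ) - 2) + m)) (L (s + 2))
  have h₃ := IsGram.const_mul (by positivity : 0 ≤ β * ((s : ℝ) + 2) * (s + 3)) (L (s + 3))
  have h₄ := ((L 1).add (IsGram.const hm₀)).mul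
    ((IsGram.const_mul (by positivity : 0 ≤ α * (s * ((q : ℝ) - 2))) (L s)).add
      (IsGram.const_mul (by positivity : 0 ≤ β * (((s : ℝ) + 1) * (q - 2))) (L (s + 1))))
  have h₅ := IsGram.const_mul (by positivity : 0 ≤ β * ((q : ℝ) - 1) * m * α)
    ((L (s + 1)).mul (L s))
  have h₆ := IsGram.const_mul (by positivity : 0 ≤ ((q : ℝ) - 1) * m * (s + 1))
    (isGram_elemSym_sq_sub (m := m) hq (s + 1))
  convert (((((((hU.add hT).add h₀).add h₁).add h₂).add h₃).add h₄).mul hG).add (h₅.add h₆)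
    using 3 with x y
  have r₀ := sum_mul_elemSym (letterKernel x y) _ _ (letterKernel_sq x y) s
  have r₁ := sum_mul_elemSym (letterKernel x y) _ _ (letterKernel_sq x y) (s + 1)
  have r₂ := sum_mul_elemSym (letterKernel x y) _ _ (letterKernel_sq x y) (s + 2)
  rw [elemSymErase_succ, Fintype.card_fin] at r₁ r₂
  push_cast at r₁ r₂
  rw [elemSym_one]
  set X := ∑ l, letterKernel x y l
  set T := elemSymErase (letterKernel x y) s
  generalize elemSym (letterKernel x y) s = L₀ at *
  generalize elemSym (letterKernel x y) (s + 1) = L₁ at *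
  generalize elemSym (letterKernel x y) (s + 2) = L₂ at *
  generalize elemSym (letterKernel x y) (s + 3) = L₃ at *
  have key : (X - α * β) * (α * L₀ + β * L₁) =
      α * (((q : ℝ) - 1) * T) - β * (q - 1) * s * L₀ + β * (s + 2) * L₂ +
        (α * (s * (q - 2)) * L₀ + β * ((s + 1) * (q - 2)) * L₁) := by
    linear_combination α * r₀ + β * r₁ - β * L₀ * hα₂ - α * L₁ * hβ₂
  have key₂ : (X + m) * ((X - α * β) * (α * L₀ + β * L₁)) =
      α * (q - 1) * (X * T - s * (m - s + 1) * L₀) + (m * α - β * (q - 1) * s) * (q - 1) * T +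
      (α * s * ((q - 1) * (m - s + 1)) - β * (q - 1) * s * (s * (q - 2) + m)) * L₀ +
      (β * (s + 2) * ((q - 1) * (m - s - 1)) - β * (q - 1) * s * (s + 1)) * L₁ +
      β * (s + 2) * ((s + 2) * (q - 2) + m) * L₂ + β * (s + 2) * (s + 3) * L₃ +
      (X + m) * (α * (s * (q - 2)) * L₀ + β * ((s + 1) * (q - 2)) * L₁) := by
    rw [key]
    linear_combination -β * (q - 1) * s * r₀ + β * (s + 2) * r₂
  linear_combination (α * L₀ + β * L₁) * key₂ + ((q : ℝ) - 1) * m * L₁ ^ 2 * hβ₂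

theorem lpKernel_self_le (hq : 2 ≤ q) {s : ℕ} (hm : 16 * (s + 1) * q ≤ m) (x : Fin m → Fin q) :
    lpKernel s x x ≤ ((q : ℝ) - 1) * m * (q * m) *
      (3 * (s + 1) * (m.choose (s + 1) * ((q : ℝ) - 1) ^ (s + 1))) ^ 2 := by
  have hq' : (2 : ℝ) ≤ q := by exact_mod_cast hq
  have hq₁ : (1 : ℝ) ≤ (q : ℝ) - 1 := by linarith
  have hq₀ : (0 : ℝ) ≤ (q : ℝ) - 1 := by linarith
  have hs₀ : (0 : ℝ) ≤ s := s.cast_nonneg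
  have hs : s ≤ m := by nlinarith
  have hmR : 16 * ((s : ℝ) + 1) * q ≤ m := by exact_mod_cast hm
  have hn : (1 : ℝ) ≤ (q - 1) * m := by nlinarith
  have hβ₂ : √((s : ℝ) + 1) ≤ s + 1 := Real.sqrt_le_iff.2 ⟨by linarith, by nlinarith⟩
  have hα₁ : 1 ≤ √(((q : ℝ) - 1) * m) := Real.one_le_sqrt.2 hn
  have hα₂ : √(((q : ℝ) - 1) * m) ^ 2 = ((q : ℝ) - 1) * m := Real.sq_sqrt (by linarith)
  have hβ : 0 ≤ √((s : ℝ) + 1) := Real.sqrt_nonneg _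
  have hN : (m.choose (s + 1) : ℝ) * (s + 1) = m.choose s * (m - s) := by
    have := Nat.choose_succ_right_eq m s
    rw [← Nat.cast_sub hs]
    exact_mod_cast this
  unfold lpKernel
  simp only [letterKernel_self, elemSym_const, Fintype.card_fin, sum_const, card_univ,
    nsmul_eq_mul]
  set α := √(((q : ℝ) - 1) * m)
  set β := √((s : ℝ) + 1)
  have hA : 0 ≤ (m.choose s : ℝ) * ((q : ℝ) - 1) ^ s := by positivity
  have hB : 0 ≤ (m.choose (s + 1) : ℝ) * ((q : ℝ) - 1) ^ (s + 1) := by positivity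
  have hAB : (m.choose (s + 1) : ℝ) * ((q : ℝ) - 1) ^ (s + 1) * (s + 1) =
      (m.choose s : ℝ) * ((q : ℝ) - 1) ^ s * ((q - 1) * (m - s)) := by
    rw [pow_succ]
    linear_combination ((q : ℝ) - 1) ^ s * (q - 1) * hN
  set A := (m.choose s : ℝ) * ((q : ℝ) - 1) ^ s
  set B := (m.choose (s + 1) : ℝ) * ((q : ℝ) - 1) ^ (s + 1)
  have h₁ : α * A ≤ 2 * (s + 1) * B := by
    have h₂ : α ≤ 2 * ((q - 1) * (m - s)) := by
      have : ((q : ℝ) - 1) * m ≤ 2 * ((q - 1) * (m - s)) := by nlinarith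
      nlinarith
    nlinarith [mul_le_mul_of_nonneg_right h₂ hA]
  have h₂ : β * B ≤ (s + 1) * B := mul_le_mul_of_nonneg_right hβ₂ hB
  have h₃ : (α * A + β * B) ^ 2 ≤ (3 * (s + 1) * B) ^ 2 :=
    pow_le_pow_left₀ (by positivity) (by linarith) 2
  refine mul_le_mul ?_ h₃ (by positivity) (by positivity)
  have hαβ : 0 ≤ α * β := by positivity
  have hm₀ : (0 : ℝ) ≤ m := m.cast_nonneg
  nlinarith [mul_nonneg hαβ (mul_nonneg (by linarith : (0 : ℝ) ≤ q) hm₀)]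

theorem IsCode.card_le_choose (hq : 2 ≤ q) {s : ℕ} (hm : 16 * (s + 1) * q ≤ m)
    {C : Finset (Fin m → Fin q)}
    (h : ∀ x ∈ C, ∀ y ∈ C, x ≠ y →
      ∑ l, letterKernel x y l ≤ √(((q : ℝ) - 1) * m) * √((s : ℝ) + 1)) :
    (C.card : ℝ) ≤ 9 * (s + 1) * q * m * (m.choose (s + 1) * ((q : ℝ) - 1) ^ (s + 1)) := by
  have hq' : (2 : ℝ) ≤ q := by exact_mod_cast hq
  have hq₁ : (0 : ℝ) < (q : ℝ) - 1 := by linarith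
  have hs : s + 1 ≤ m := by nlinarith
  have hm₀ : (0 : ℝ) < m := by exact_mod_cast (by omega : 0 < m)
  have hN : (0 : ℝ) < m.choose (s + 1) * ((q : ℝ) - 1) ^ (s + 1) := by
    have : (0 : ℝ) < m.choose (s + 1) := by exact_mod_cast Nat.choose_pos hs
    positivity
  have hle := (isGram_lpKernel_sub hq hm).card_mul_le C (fun x hx y hy hxy =>
    mul_nonpos_of_nonpos_of_nonneg (mul_nonpos_of_nonpos_of_nonneg (sub_nonpos.2 (h x hx y hy hxy))
      (sum_letterKernel_add_nonneg x y)) (sq_nonneg _))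
    (fun x _ => lpKernel_self_le hq hm x) (by positivity)
  have hw : 0 < ((s : ℝ) + 1) * (((q : ℝ) - 1) * m) *
      (m.choose (s + 1) * ((q : ℝ) - 1) ^ (s + 1)) := by positivity
  refine le_of_mul_le_mul_right (hle.trans_eq ?_) hw
  ring

end LinearProgramming

/-- For every integer `q ≥ 2` and positive integer `k` there is `C = C(q,k) > 0` such
that for all positive integers `r` and reals `0 ≤ j ≤ √((k-1) r / (q-1))`, one has
`A_q(r, (1 - 1/q)(r - j)) ≤ C r^k`. -/
theorem code_upper_bound (q k : ℕ) (hq : 2 ≤ q) (hk : 0 < k) :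
    ∃ C : ℝ, 0 < C ∧ ∀ r : ℕ, 0 < r → ∀ j : ℝ, 0 ≤ j →
      j ≤ Real.sqrt (((k : ℝ) - 1) * r / ((q : ℝ) - 1)) →
      (maxCodeSize q r ((1 - 1 / (q : ℝ)) * ((r : ℝ) - j)) : ℝ) ≤ C * (r : ℝ) ^ k := by
  have hq' : (2 : ℝ) ≤ q := by exact_mod_cast hq
  have hq₁ : (0 : ℝ) < (q : ℝ) - 1 := by linarith
  obtain rfl | ⟨s, rfl⟩ : k = 1 ∨ ∃ s, k = s + 2 := by
    rcases k with _ | _ | s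
    · omega
    · exact Or.inl rfl
    · exact Or.inr ⟨s, rfl⟩
  · refine ⟨q, by linarith, fun r hr j _ hj => maxCodeSize_le fun C hC => ?_⟩
    have hj₀ : j ≤ 0 := by simpa using hj
    rw [pow_one]
    exact IsCode.card_le_mul hq hr fun x hx y hy hxy =>
      (hC.sum_letterKernel_le (by omega) hx hy hxy).trans
        (mul_nonpos_of_nonneg_of_nonpos hq₁.le hj₀)
  · refine ⟨9 * (s + 1) * q * ((q : ℝ) - 1) ^ (s + 1) + (q : ℝ) ^ (16 * (s + 1) * q),
      by positivity, fun r hr j _ hj => maxCodeSize_le fun C hC => ?_⟩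
    have hr₀ : (0 : ℝ) < r := by exact_mod_cast hr
    have hr₁ : (1 : ℝ) ≤ r := by exact_mod_cast hr
    rw [add_mul]
    rcases le_total (16 * (s + 1) * q) r with hlarge | hsmall
    · have hj' : ((q : ℝ) - 1) * j ≤ √(((q : ℝ) - 1) * r) * √((s : ℝ) + 1) := by
        refine (mul_le_mul_of_nonneg_left hj hq₁.le).trans_eq ?_
        rw [← Real.sqrt_mul (by positivity)]
        nth_rw 1 [← Real.sqrt_sq hq₁.le]
        rw [← Real.sqrt_mul (by positivity)]
        congr 1
        push_cast
        field_simp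
        ring
      have h := IsCode.card_le_choose hq hlarge fun x hx y hy hxy =>
        (hC.sum_letterKernel_le (by omega) hx hy hxy).trans hj'
      have hchoose : (r.choose (s + 1) : ℝ) ≤ (r : ℝ) ^ (s + 1) := by
        exact_mod_cast Nat.choose_le_pow r (s + 1)
      have hmain : 9 * ((s : ℝ) + 1) * q * r * (r.choose (s + 1) * ((q : ℝ) - 1) ^ (s + 1)) ≤
          9 * (s + 1) * q * r * ((r : ℝ) ^ (s + 1) * ((q : ℝ) - 1) ^ (s + 1)) := by gcongr
      have hrest : 0 ≤ (q : ℝ) ^ (16 * (s + 1) * q) * (r : ℝ) ^ (s + 2) := by positivity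
      have hpow : (r : ℝ) ^ (s + 2) = r ^ (s + 1) * r := pow_succ _ _
      rw [hpow] at hrest ⊢
      linarith
    · have h₁ : (C.card : ℝ) ≤ (q : ℝ) ^ r := by
        have := card_le_univ C
        simp only [Fintype.card_fun, Fintype.card_fin] at this
        exact_mod_cast this
      have h₂ : (q : ℝ) ^ r ≤ (q : ℝ) ^ (16 * (s + 1) * q) :=
        pow_le_pow_right₀ (by linarith) hsmall
      have h₃ : (q : ℝ) ^ (16 * (s + 1) * q) ≤
          (q : ℝ) ^ (16 * (s + 1) * q) * (r : ℝ) ^ (s + 2) :=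
        le_mul_of_one_le_right (by positivity) (one_le_pow₀ hr₁)
      have h₄ : 0 ≤ 9 * ((s : ℝ) + 1) * q * ((q : ℝ) - 1) ^ (s + 1) * (r : ℝ) ^ (s + 2) := by
        positivity
      linarith
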